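/- Let W(x0,x1,x2,x3) be the 10×10 skew-symmetric matrix with rows (0,0,0,0,0,0,0,x0,x1,0), (0,0,0,0,0,0,x0,x1,0,x2), (0,0,0,0,0,−x0,x1,0,x2,x3), (0,0,0,0,x0,x1,0,x2,x3,0), (0,0,0,−x0,0,0,x2,−x3,0,0), (0,0,x0,−x1,0,0,x3,0,0,0), (0,−x0,−x1,0,−x2,−x3,0,0,0,0), (−x0,−x1,0,−x2,x3,0,0,0,0,0), (−x1,0,−x2,−x3,0,0,0,0,0,0), (0,−x2,−x3,0,0,0,0,0,0,0). Then for every (x0,x1,x2,x3) ∈ ℂ⁴ with (x0,x1,x2,x3) ≠ (0,0,0,0), the rank of W(x0,x1,x2,x3) equals 8. -/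

import Mathlib

/-- Westwick's 10×10 skew-symmetric matrix of linear forms. -/
def westwickMatrix (x0 x1 x2 x3 : ℂ) : Matrix (Fin 10) (Fin 10) ℂ :=
  Matrix.of
    ![![0, 0, 0, 0, 0, 0, 0, x0, x1, 0],
      ![0, 0, 0, 0, 0, 0, x0, x1, 0, x2],
      ![0, 0, 0, 0, 0, -x0, x1, 0, x2, x3],
      ![0, 0, 0, 0, x0, x1, 0, x2, x3, 0],
      ![0, 0, 0, -x0, 0, 0, x2, -x3, 0, 0],
      ![0, 0, x0, -x1, 0, 0, x3, 0, 0, 0],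
      ![0, -x0, -x1, 0, -x2, -x3, 0, 0, 0, 0],
      ![-x0, -x1, 0, -x2, x3, 0, 0, 0, 0, 0],
      ![-x1, 0, -x2, -x3, 0, 0, 0, 0, 0, 0],
      ![0, -x2, -x3, 0, 0, 0, 0, 0, 0, 0]]

/-- If the kernel of `M` is parametrised by two coordinates, then `M` has rank 8. -/
lemma rank_eq_eight (M : Matrix (Fin 10) (Fin 10) ℂ) (i j : Fin 10) (u w : Fin 10 → ℂ)
    (hu : M.mulVec u = 0) (hw : M.mulVec w = 0)
    (hui : u i ≠ 0) (huj : u j = 0) (hwi : w i = 0) (hwj : w j ≠ 0)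
    (hv : ∀ v : Fin 10 → ℂ, M.mulVec v = 0 → v i = 0 → v j = 0 → v = 0) :
    M.rank = 8 := by
  let f : LinearMap.ker M.mulVecLin →ₗ[ℂ] ℂ × ℂ :=
    ((LinearMap.proj i).prod (LinearMap.proj j)).comp (LinearMap.ker M.mulVecLin).subtype
  have hf : Function.Bijective f := by
    constructor
    · rw [injective_iff_map_eq_zero]
      rintro ⟨v, hv0⟩ h
      have h1 : v i = 0 := congrArg Prod.fst h
      have h2 : v j = 0 := congrArg Prod.snd h
      exact Subtype.ext (hv v (by simpa using hv0) h1 h2)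
    · rintro ⟨a, b⟩
      refine ⟨⟨(a / u i) • u + (b / w j) • w, ?_⟩, ?_⟩
      · simp [Matrix.mulVec_add, Matrix.mulVec_smul, hu, hw]
      · refine Prod.ext ?_ ?_
        · change (a / u i) * u i + (b / w j) * w i = a
          rw [hwi]; field_simp; simp
        · change (a / u i) * u j + (b / w j) * w j = b
          rw [huj]; field_simp; simp
  have h2 : Module.finrank ℂ (LinearMap.ker M.mulVecLin) = 2 := by
    rw [(LinearEquiv.ofBijective f hf).finrank_eq]; simp
  have h3 := LinearMap.finrank_range_add_finrank_ker M.mulVecLin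
  rw [h2] at h3
  simp at h3
  unfold Matrix.rank
  omega

/-- The ten linear equations describing the kernel of Westwick's matrix. -/
lemma westwick_mulVec_eq_zero_iff (x0 x1 x2 x3 : ℂ) (v : Fin 10 → ℂ) :
    (westwickMatrix x0 x1 x2 x3).mulVec v = 0 ↔
      (x0) * v 7 + (x1) * v 8 = 0 ∧
      (x0) * v 6 + (x1) * v 7 + (x2) * v 9 = 0 ∧
      (-x0) * v 5 + (x1) * v 6 + (x2) * v 8 + (x3) * v 9 = 0 ∧
      (x0) * v 4 + (x1) * v 5 + (x2) * v 7 + (x3) * v 8 = 0 ∧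
      (-x0) * v 3 + (x2) * v 6 + (-x3) * v 7 = 0 ∧
      (x0) * v 2 + (-x1) * v 3 + (x3) * v 6 = 0 ∧
      (-x0) * v 1 + (-x1) * v 2 + (-x2) * v 4 + (-x3) * v 5 = 0 ∧
      (-x0) * v 0 + (-x1) * v 1 + (-x2) * v 3 + (x3) * v 4 = 0 ∧
      (-x1) * v 0 + (-x2) * v 2 + (-x3) * v 3 = 0 ∧
      (-x2) * v 1 + (-x3) * v 2 = 0 := by
  rw [funext_iff]
  simp [Fin.forall_fin_succ, westwickMatrix, Matrix.mulVec, dotProduct, Fin.sum_univ_succ]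
  ring_nf
  exact fun _ => trivial

lemma rank_of_x3 (x0 x1 x2 x3 : ℂ) (hx : x3 ≠ 0) :
    (westwickMatrix x0 x1 x2 x3).rank = 8 := by
  refine rank_eq_eight _ 0 1
      ![-x3^4, 0, 0, x1*x3^3, -x0*x3^3 + x1*x2*x3^2, x0*x2*x3^2 - x1*x2^2*x3, x1^2*x3^2, -x0*x1*x3^2 + x1^2*x2*x3, x0^2*x3^2 - x0*x1*x2*x3, -x1^3*x3]
      ![0, x3^4, -x2*x3^3, x2^2*x3^2, x1*x3^3 + x2^3*x3, -x0*x3^3 - x2^4, x0*x2*x3^2 + x1*x2^2*x3, x1*x2^3, -x0*x2^3, -x0^2*x3^2 - x0*x1*x2*x3 - x1^2*x2^2] ?_ ?_ ?_ ?_ ?_ ?_ ?_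
  · rw [westwick_mulVec_eq_zero_iff]
    refine ⟨?_, ?_, ?_, ?_, ?_, ?_, ?_, ?_, ?_, ?_⟩ <;> simp <;> ring
  · rw [westwick_mulVec_eq_zero_iff]
    refine ⟨?_, ?_, ?_, ?_, ?_, ?_, ?_, ?_, ?_, ?_⟩ <;> simp <;> ring
  · simp [hx]
  · simp
  · simp
  · simp [hx]
  · intro v hv a b
    rw [westwick_mulVec_eq_zero_iff] at hv
    obtain ⟨e0, e1, e2, e3, e4, e5, e6, e7, e8, e9⟩ := hv
    have h2 : v 2 = 0 := by simpa [hx, a, b] using e9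
    have h3 : v 3 = 0 := by simpa [hx, a, b, h2] using e8
    have h4 : v 4 = 0 := by simpa [hx, a, b, h2, h3] using e7
    have h5 : v 5 = 0 := by simpa [hx, a, b, h2, h3, h4] using e6
    have h6 : v 6 = 0 := by simpa [hx, a, b, h2, h3, h4, h5] using e5
    have h7 : v 7 = 0 := by simpa [hx, a, b, h2, h3, h4, h5, h6] using e4
    have h8 : v 8 = 0 := by simpa [hx, a, b, h2, h3, h4, h5, h6, h7] using e3
    have h9 : v 9 = 0 := by simpa [hx, a, b, h2, h3, h4, h5, h6, h7, h8] using e2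
    funext k
    fin_cases k <;> simp [a, b, h2, h3, h4, h5, h6, h7, h8, h9]

lemma rank_of_x0 (x0 x1 x2 x3 : ℂ) (hx : x0 ≠ 0) :
    (westwickMatrix x0 x1 x2 x3).rank = 8 := by
  refine rank_eq_eight _ 8 9
      ![x0^2*x3^2 + x0*x1*x2*x3 + x1^2*x2^2, x1^3*x3, -x1^3*x2, -x0^2*x1*x3 - x0*x1^2*x2, x0^3*x3 + x1^4, -x0^3*x2 - x0*x1^3, -x0^2*x1^2, x0^3*x1, -x0^4, 0]
      ![x0*x2^3, -x0^2*x3^2 + x0*x1*x2*x3, x0^2*x2*x3 - x0*x1*x2^2, -x0^2*x2^2, -x0^2*x1*x3 + x0*x1^2*x2, x0^3*x3 - x0^2*x1*x2, -x0^3*x2, 0, 0, x0^4] ?_ ?_ ?_ ?_ ?_ ?_ ?_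
  · rw [westwick_mulVec_eq_zero_iff]
    refine ⟨?_, ?_, ?_, ?_, ?_, ?_, ?_, ?_, ?_, ?_⟩ <;> simp <;> ring
  · rw [westwick_mulVec_eq_zero_iff]
    refine ⟨?_, ?_, ?_, ?_, ?_, ?_, ?_, ?_, ?_, ?_⟩ <;> simp <;> ring
  · simp [hx]
  · simp
  · simp
  · simp [hx]
  · intro v hv a b
    rw [westwick_mulVec_eq_zero_iff] at hv
    obtain ⟨e0, e1, e2, e3, e4, e5, e6, e7, e8, e9⟩ := hv
    have h7 : v 7 = 0 := by simpa [hx, a, b] using e0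
    have h6 : v 6 = 0 := by simpa [hx, a, b, h7] using e1
    have h5 : v 5 = 0 := by simpa [hx, a, b, h7, h6] using e2
    have h4 : v 4 = 0 := by simpa [hx, a, b, h7, h6, h5] using e3
    have h3 : v 3 = 0 := by simpa [hx, a, b, h7, h6, h5, h4] using e4
    have h2 : v 2 = 0 := by simpa [hx, a, b, h7, h6, h5, h4, h3] using e5
    have h1 : v 1 = 0 := by simpa [hx, a, b, h7, h6, h5, h4, h3, h2] using e6
    have h0 : v 0 = 0 := by simpa [hx, a, b, h7, h6, h5, h4, h3, h2, h1] using e7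
    funext k
    fin_cases k <;> simp [a, b, h7, h6, h5, h4, h3, h2, h1, h0]

lemma rank_of_x1 (x1 x2 : ℂ) (hx : x1 ≠ 0) :
    (westwickMatrix 0 x1 x2 0).rank = 8 := by
  refine rank_eq_eight _ 4 9
      ![x1^2*x2^2, 0, -x1^3*x2, 0, x1^4, 0, 0, 0, 0, 0]
      ![0, 0, 0, 0, 0, -x1^2*x2^2, 0, x1^3*x2, 0, -x1^4] ?_ ?_ ?_ ?_ ?_ ?_ ?_
  · rw [westwick_mulVec_eq_zero_iff]
    refine ⟨?_, ?_, ?_, ?_, ?_, ?_, ?_, ?_, ?_, ?_⟩ <;> simp <;> ring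
  · rw [westwick_mulVec_eq_zero_iff]
    refine ⟨?_, ?_, ?_, ?_, ?_, ?_, ?_, ?_, ?_, ?_⟩ <;> simp <;> ring
  · simp [hx]
  · simp
  · simp
  · simp [hx]
  · intro v hv a b
    rw [westwick_mulVec_eq_zero_iff] at hv
    obtain ⟨e0, e1, e2, e3, e4, e5, e6, e7, e8, e9⟩ := hv
    have h8 : v 8 = 0 := by simpa [hx, a, b] using e0
    have h7 : v 7 = 0 := by simpa [hx, a, b, h8] using e1
    have h6 : v 6 = 0 := by simpa [hx, a, b, h8, h7] using e2
    have h5 : v 5 = 0 := by simpa [hx, a, b, h8, h7, h6] using e3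
    have h3 : v 3 = 0 := by simpa [hx, a, b, h8, h7, h6, h5] using e5
    have h2 : v 2 = 0 := by simpa [hx, a, b, h8, h7, h6, h5, h3] using e6
    have h0 : v 0 = 0 := by simpa [hx, a, b, h8, h7, h6, h5, h3, h2] using e8
    have h1 : v 1 = 0 := by simpa [hx, a, b, h8, h7, h6, h5, h3, h2, h0] using e7
    funext k
    fin_cases k <;> simp [a, b, h8, h7, h6, h5, h3, h2, h0, h1]

lemma rank_of_x2 (x1 x2 : ℂ) (hx : x2 ≠ 0) :
    (westwickMatrix 0 x1 x2 0).rank = 8 := by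
  refine rank_eq_eight _ 0 5
      ![x2^4, 0, -x1*x2^3, 0, x1^2*x2^2, 0, 0, 0, 0, 0]
      ![0, 0, 0, 0, 0, -x2^4, 0, x1*x2^3, 0, -x1^2*x2^2] ?_ ?_ ?_ ?_ ?_ ?_ ?_
  · rw [westwick_mulVec_eq_zero_iff]
    refine ⟨?_, ?_, ?_, ?_, ?_, ?_, ?_, ?_, ?_, ?_⟩ <;> simp <;> ring
  · rw [westwick_mulVec_eq_zero_iff]
    refine ⟨?_, ?_, ?_, ?_, ?_, ?_, ?_, ?_, ?_, ?_⟩ <;> simp <;> ring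
  · simp [hx]
  · simp
  · simp
  · simp [hx]
  · intro v hv a b
    rw [westwick_mulVec_eq_zero_iff] at hv
    obtain ⟨e0, e1, e2, e3, e4, e5, e6, e7, e8, e9⟩ := hv
    have h7 : v 7 = 0 := by simpa [hx, a, b] using e3
    have h9 : v 9 = 0 := by simpa [hx, a, b, h7] using e1
    have h6 : v 6 = 0 := by simpa [hx, a, b, h7, h9] using e4
    have h8 : v 8 = 0 := by simpa [hx, a, b, h7, h9, h6] using e2
    have h2 : v 2 = 0 := by simpa [hx, a, b, h7, h9, h6, h8] using e8
    have h4 : v 4 = 0 := by simpa [hx, a, b, h7, h9, h6, h8, h2] using e6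
    have h1 : v 1 = 0 := by simpa [hx, a, b, h7, h9, h6, h8, h2, h4] using e9
    have h3 : v 3 = 0 := by simpa [hx, a, b, h7, h9, h6, h8, h2, h4, h1] using e7
    funext k
    fin_cases k <;> simp [a, b, h7, h9, h6, h8, h2, h4, h1, h3]

/-- Westwick's matrix has constant rank 8 away from the origin. -/
theorem westwick_constant_rank (x0 x1 x2 x3 : ℂ)
    (h : ¬(x0 = 0 ∧ x1 = 0 ∧ x2 = 0 ∧ x3 = 0)) :
    (westwickMatrix x0 x1 x2 x3).rank = 8 := by
  by_cases h3 : x3 = 0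
  · by_cases h0 : x0 = 0
    · subst h3 h0
      by_cases h1 : x1 = 0
      · by_cases h2 : x2 = 0
        · exact absurd ⟨rfl, h1, h2, rfl⟩ h
        · exact rank_of_x2 x1 x2 h2
      · exact rank_of_x1 x1 x2 h1
    · exact rank_of_x0 x0 x1 x2 x3 h0
  · exact rank_of_x3 x0 x1 x2 x3 h3
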